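/- For integers r ≥ 1, 0 ≤ m ≤ r, and n ≥ 0, the sets S(r,m)_n and S(r,r−m)_n have the same number of elements: ♯S(r,m)_n = ♯S(r,r−m)_n. -/

import Mathlib

open PowerSeries

noncomputable section

/-- The product (coefficientwise) topology on `ℚ⟦X⟧`. -/
instance : TopologicalSpace ℚ⟦X⟧ :=
  inferInstanceAs (TopologicalSpace ((Unit →₀ ℕ) → ℚ))

/-- `(q)_n = ∏_{i=1}^n (1 - q^i)` in `ℚ⟦X⟧`. -/
def qp (n : ℕ) : ℚ⟦X⟧ := ∏ i ∈ Finset.range n, (1 - X ^ (i + 1))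

/-- `(-q)_n = ∏_{i=1}^n (1 + q^i)` in `ℚ⟦X⟧`. -/
def nqp (n : ℕ) : ℚ⟦X⟧ := ∏ i ∈ Finset.range n, (1 + X ^ (i + 1))

/-- The Gaussian binomial `[M, N]_q`, zero unless `M ≥ N`. -/
def qbinom (M N : ℕ) : ℚ⟦X⟧ :=
  if N ≤ M then qp M * ((qp N)⁻¹ * (qp (M - N))⁻¹) else 0

/-- Weakly decreasing tuples `f 0 ≥ f 1 ≥ … ≥ f (r-1) ≥ 0`, encoded as
antitone functions `ℕ → ℕ` vanishing from index `r` on. -/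
def DecTuple (r : ℕ) : Type :=
  {f : ℕ → ℕ // (∀ ⦃i j : ℕ⦄, i ≤ j → f j ≤ f i) ∧ ∀ i, r ≤ i → f i = 0}

/-- `(q)_λ = (q)_{λ_1-λ_2} ⋯ (q)_{λ_{r-1}-λ_r} (q)_{λ_r}` for a weakly
decreasing tuple `λ` (0-indexed). -/
def qpT (r : ℕ) (f : ℕ → ℕ) : ℚ⟦X⟧ := ∏ i ∈ Finset.range r, qp (f i - f (i + 1))


/-- Tuples `(λ^(1), …, λ^(r))` of distinct-part partitions (a distinct-part
partition being encoded as its finite set of (positive) parts, `L i` encoding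
`λ^(i+1)`) satisfying `λ^(i)_1 ≤ l(λ^(i+1)) + δ_{i,m}` for `1 ≤ i ≤ r-1`;
here `(L i).sup id` is the largest part and `(L i).card` the number of parts. -/
def Srm (r m : ℕ) : Set (ℕ → Finset ℕ) :=
  {L | (∀ i, r ≤ i → L i = ∅) ∧ (∀ i, 0 ∉ L i) ∧
    ∀ i, i + 2 ≤ r → (L i).sup id ≤ (L (i + 1)).card + if i + 1 = m then 1 else 0}

/-- The subset `S(r,m)_n` of `S(r,m)` where the total size is `n`. -/
def Srmn (r m n : ℕ) : Set (ℕ → Finset ℕ) :=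
  {L ∈ Srm r m | ∑ i ∈ Finset.range r, (L i).sum id = n}

section Operators

variable {A : Type*} [CommRing A]

/-- `distinctOp q g N = ∑_{S ⊆ {1, …, N}} q^{∑ S} g(♯S)`, defined by recursion on `N`. -/
def distinctOp (q : A) : (ℕ → A) → ℕ → A
  | g, 0 => g 0
  | g, n + 1 => distinctOp q g n + q ^ (n + 1) * distinctOp q (fun k => g (k + 1)) n

/-- `distinctOpTwist q g N = ∑_{S ⊆ {1, …, N}} q^{∑ S + N - ♯S} g(♯S)`, the conjugate of
`distinctOp q` by multiplication by `q^N`. -/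
def distinctOpTwist (q : A) : (ℕ → A) → ℕ → A
  | g, 0 => g 0
  | g, n + 1 => q * distinctOpTwist q g n + q ^ (n + 1) * distinctOpTwist q (fun k => g (k + 1)) n

theorem distinctOp_linear (q a b : A) (f g : ℕ → A) (n : ℕ) :
    distinctOp q (fun k => a * f k + b * g k) n = a * distinctOp q f n + b * distinctOp q g n := by
  induction n generalizing f g with
  | zero => rfl
  | succ n ih =>
    simp only [distinctOp]
    rw [ih, ih (fun k => f (k + 1)) (fun k => g (k + 1))]
    ring

theorem distinctOpTwist_linear (q a b : A) (f g : ℕ → A) (n : ℕ) :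
    distinctOpTwist q (fun k => a * f k + b * g k) n =
      a * distinctOpTwist q f n + b * distinctOpTwist q g n := by
  induction n generalizing f g with
  | zero => rfl
  | succ n ih =>
    simp only [distinctOpTwist]
    rw [ih, ih (fun k => f (k + 1)) (fun k => g (k + 1))]
    ring

theorem distinctOpTwist_pow_mul (q : A) (g : ℕ → A) (n : ℕ) :
    distinctOpTwist q (fun k => q ^ k * g k) n = q ^ n * distinctOp q g n := by
  induction n generalizing g with
  | zero => rfl
  | succ n ih =>
    have h : (fun k => q ^ (k + 1) * g (k + 1)) =
        fun k => q * (q ^ k * g (k + 1)) + 0 * (q ^ k * g (k + 1)) := by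
      funext k; ring
    simp only [distinctOp, distinctOpTwist]
    rw [h, distinctOpTwist_linear, ih, ih (fun k => g (k + 1))]
    ring

theorem distinctOp_pow_mul_distinctOpTwist (q c : A) (g : ℕ → A) (n : ℕ) :
    distinctOp q (fun k => c ^ k * distinctOpTwist q g k) n =
      distinctOp q (fun k => c ^ k * distinctOp q g k) n
        - q * c * distinctOp q (fun k => (c * q) ^ k * distinctOp q g k) n
        + q * c * q ^ n * distinctOp q (fun k => c ^ k * distinctOp q g k) n := by
  induction n generalizing g c with
  | zero => simp [distinctOp, distinctOpTwist]
  | succ n ih =>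
    have hR (c : A) : (fun k => c ^ (k + 1) * distinctOpTwist q g (k + 1)) =
        fun k => (c * q) * (c ^ k * distinctOpTwist q g k) +
          (c * q) * ((c * q) ^ k * distinctOpTwist q (fun k => g (k + 1)) k) := by
      funext k; simp only [distinctOpTwist]; ring
    have hT (c : A) : (fun k => c ^ (k + 1) * distinctOp q g (k + 1)) =
        fun k => c * (c ^ k * distinctOp q g k) +
          (c * q) * ((c * q) ^ k * distinctOp q (fun k => g (k + 1)) k) := by
      funext k; simp only [distinctOp]; ring
    rw [distinctOp, distinctOp, distinctOp, hR, hT, hT]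
    simp only [distinctOp_linear]
    rw [ih, ih (c * q) (fun k => g (k + 1))]
    ring

/-- The special case without the extra factor `c ^ k`. -/
theorem distinctOp_distinctOpTwist (q : A) (g : ℕ → A) (n : ℕ) :
    distinctOp q (distinctOpTwist q g) n =
      distinctOp q (distinctOp q g) n
        - q * distinctOp q (fun k => q ^ k * distinctOp q g k) n
        + q * q ^ n * distinctOp q (distinctOp q g) n := by
  simpa using distinctOp_pow_mul_distinctOpTwist q 1 g n

/-- `a` applications of `distinctOp q` to the unit shift of `b` applications of `distinctOp q`
to the constant function `1`. -/
def shiftedIter (q : A) (a b : ℕ) : ℕ → A :=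
  (distinctOp q)^[a] fun k => (distinctOp q)^[b] (fun _ => 1) (k + 1)

/-- A correction of `shiftedIter` by a multiple of `q ^ (N + 1)` which is symmetric
in `a` and `b`. -/
def symmIter (q : A) (a : ℕ) : ℕ → ℕ → A
  | 0 => shiftedIter q a 0
  | b + 1 => fun n =>
      1 * shiftedIter q a (b + 1) n + (-q) * (q ^ n * distinctOp q (shiftedIter q a b) n)

theorem shiftedIter_succ (q : A) (a b : ℕ) :
    shiftedIter q (a + 1) b = distinctOp q (shiftedIter q a b) :=
  Function.iterate_succ_apply' _ _ _

theorem symmIter_zero_left (q : A) (b : ℕ) :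
    symmIter q 0 b = (distinctOp q)^[b] fun _ => 1 := by
  cases b with
  | zero => rfl
  | succ b =>
    funext n
    simp only [symmIter, shiftedIter, Function.iterate_zero, id, Function.iterate_succ_apply',
      distinctOp]
    ring

theorem symmIter_succ_succ (q : A) (a b n : ℕ) :
    symmIter q (a + 1) (b + 1) n =
      distinctOp q (symmIter q a (b + 1)) n + distinctOp q (symmIter q (a + 1) b) n
        - distinctOp q (distinctOpTwist q (symmIter q a b)) n := by
  cases b with
  | zero =>
    simp only [symmIter, distinctOp_linear, distinctOp_distinctOpTwist, shiftedIter_succ]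
    ring
  | succ b =>
    have h : distinctOpTwist q (symmIter q a (b + 1)) =
        fun k => 1 * distinctOpTwist q (shiftedIter q a (b + 1)) k
          + (-q) * (q ^ k * distinctOp q (distinctOp q (shiftedIter q a b)) k) := by
      funext k
      simp only [symmIter, distinctOpTwist_linear, distinctOpTwist_pow_mul]
    rw [h]
    simp only [symmIter, distinctOp_linear, distinctOp_distinctOpTwist, shiftedIter_succ]
    ring

theorem symmIter_comm (q : A) (a b : ℕ) : symmIter q a b = symmIter q b a := by
  induction a generalizing b with
  | zero => rw [symmIter_zero_left]; rfl
  | succ a iha =>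
    induction b with
    | zero => rw [symmIter_zero_left]; rfl
    | succ b ihb =>
      funext n
      rw [symmIter_succ_succ, symmIter_succ_succ, iha (b + 1), ihb, iha b]
      ring

theorem distinctOp_eq_sum_powerset (q : A) (g : ℕ → A) (n : ℕ) :
    distinctOp q g n = ∑ S ∈ (Finset.Icc 1 n).powerset, q ^ S.sum id * g S.card := by
  induction n generalizing g with
  | zero => simp [distinctOp]
  | succ n ih =>
    have hn : n + 1 ∉ Finset.Icc 1 n := by simp
    rw [← Finset.insert_Icc_right_eq_Icc_add_one (by omega), Finset.sum_powerset_insert hn,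
      distinctOp, ih, ih, Finset.mul_sum]
    congr 1
    refine Finset.sum_congr rfl fun S hS => ?_
    have hS' : n + 1 ∉ S := fun h => hn (Finset.mem_powerset.1 hS h)
    rw [Finset.sum_insert hS', Finset.card_insert_of_notMem hS', id, pow_add _ (n + 1),
      mul_assoc]

end Operators

/-- If `q ^ (N + 1)` does not contribute to the coefficient of `X ^ n`, `shiftedIter` has the same
coefficient as its symmetric correction. -/
theorem coeff_symmIter (a b : ℕ) {n N : ℕ} (h : n ≤ N) :
    (symmIter (Polynomial.X : Polynomial ℤ) a b N).coeff n =
      (shiftedIter (Polynomial.X : Polynomial ℤ) a b N).coeff n := by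
  cases b with
  | zero => rfl
  | succ b =>
    simp only [symmIter]
    rw [one_mul, neg_mul, ← mul_assoc, ← pow_succ', Polynomial.coeff_add,
      Polynomial.coeff_neg, Polynomial.coeff_X_pow_mul', if_neg (by omega)]
    simp

open scoped Classical in
/-- The elements of `S(r,m)` whose last partition has largest part at most `N + δ_{r,m}`. -/
def boundedSrm (m : ℕ) : ℕ → ℕ → Finset (ℕ → Finset ℕ)
  | 0, _ => {fun _ => ∅}
  | r + 1, N => (Finset.Icc 1 (N + if r + 1 = m then 1 else 0)).powerset.biUnion fun S =>
      (boundedSrm m r S.card).image fun L => Function.update L r S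

theorem mem_boundedSrm (m r N : ℕ) (L : ℕ → Finset ℕ) :
    L ∈ boundedSrm m r N ↔ L ∈ Srm r m ∧
      ∀ i, i + 1 = r → (L i).sup id ≤ N + if i + 1 = m then 1 else 0 := by
  induction r generalizing N L with
  | zero =>
    simp only [boundedSrm, Finset.mem_singleton, Srm, Set.mem_ofPred_eq]
    constructor
    · rintro rfl
      simp
    · rintro ⟨⟨h, -⟩, -⟩
      funext i
      exact h i (Nat.zero_le i)
  | succ r ih =>
    simp only [boundedSrm, Finset.mem_biUnion, Finset.mem_image, Finset.mem_powerset, ih, Srm,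
      Set.mem_ofPred_eq]
    constructor
    · rintro ⟨S, hS, L, ⟨⟨h1, h2, h3⟩, h4⟩, rfl⟩
      refine ⟨⟨fun i hi => ?_, fun i => ?_, fun i hi => ?_⟩, fun i hi => ?_⟩
      · rw [Function.update_of_ne (by omega)]
        exact h1 i (by omega)
      · by_cases hir : i = r
        · subst hir
          rw [Function.update_self]
          intro h0
          simpa using hS h0
        · rw [Function.update_of_ne hir]
          exact h2 i
      · rw [Function.update_of_ne (by omega)]
        by_cases hir : i + 1 = r
        · subst hir
          rw [Function.update_self]
          exact h4 i rfl
        · rw [Function.update_of_ne hir]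
          exact h3 i (by omega)
      · obtain rfl : i = r := by omega
        rw [Function.update_self]
        exact Finset.sup_le fun x hx => (Finset.mem_Icc.1 (hS hx)).2
    · rintro ⟨⟨h1, h2, h3⟩, h4⟩
      refine ⟨L r, fun x hx => Finset.mem_Icc.2 ⟨?_, ?_⟩, Function.update L r ∅,
        ⟨⟨fun i hi => ?_, fun i => ?_, fun i hi => ?_⟩, fun i hi => ?_⟩, by simp⟩
      · exact Nat.pos_of_ne_zero fun h => h2 r (h ▸ hx)
      · exact (Finset.le_sup (f := id) hx).trans (h4 r rfl)
      · by_cases hir : i = r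
        · rw [hir, Function.update_self]
        · rw [Function.update_of_ne hir]
          exact h1 i (by omega)
      · by_cases hir : i = r
        · simp [hir]
        · rw [Function.update_of_ne hir]
          exact h2 i
      · rw [Function.update_of_ne (by omega), Function.update_of_ne (by omega)]
        exact h3 i (by omega)
      · rw [Function.update_of_ne (by omega)]
        subst hi
        exact h3 i le_rfl

theorem apply_eq_empty_of_mem_boundedSrm {m r N : ℕ} {L : ℕ → Finset ℕ}
    (h : L ∈ boundedSrm m r N) : L r = ∅ :=
  ((mem_boundedSrm m r N L).1 h).1.1 r le_rfl

/-- The generating function of `boundedSrm m r N` with respect to the total size. -/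
def boundedGF (m r N : ℕ) : Polynomial ℤ :=
  ∑ L ∈ boundedSrm m r N, Polynomial.X ^ ∑ i ∈ Finset.range r, (L i).sum id

theorem boundedGF_zero (m N : ℕ) : boundedGF m 0 N = 1 := by
  simp [boundedGF, boundedSrm]

open scoped Classical in
theorem boundedGF_succ (m r N : ℕ) :
    boundedGF m (r + 1) N =
      distinctOp Polynomial.X (boundedGF m r) (N + if r + 1 = m then 1 else 0) := by
  rw [distinctOp_eq_sum_powerset, boundedGF, boundedSrm, Finset.sum_biUnion]
  · refine Finset.sum_congr rfl fun S _ => ?_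
    rw [Finset.sum_image, boundedGF, Finset.mul_sum]
    · refine Finset.sum_congr rfl fun L _ => ?_
      rw [Finset.sum_range_succ, Function.update_self, add_comm, pow_add]
      congr 2
      refine Finset.sum_congr rfl fun i hi => ?_
      rw [Function.update_of_ne (Finset.mem_range.1 hi).ne]
    · intro L hL L' hL' h
      have e (K) (hK : K ∈ boundedSrm m r S.card) :
          Function.update (Function.update K r S) r ∅ = K := by
        rw [Function.update_idem, ← apply_eq_empty_of_mem_boundedSrm hK, Function.update_eq_self]
      exact (e L hL).symm.trans ((congrArg (Function.update · r ∅) h).trans (e L' hL'))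
  · intro S _ S' _ hne
    refine Finset.disjoint_left.2 fun L hL hL' => hne ?_
    obtain ⟨K, -, rfl⟩ := Finset.mem_image.1 hL
    obtain ⟨K', -, h⟩ := Finset.mem_image.1 hL'
    simpa using (congrFun h r).symm

theorem boundedGF_eq_iterate {m r : ℕ} (h : m = 0 ∨ r < m) :
    boundedGF m r = (distinctOp Polynomial.X)^[r] fun _ => 1 := by
  induction r with
  | zero => funext N; exact boundedGF_zero m N
  | succ r ih =>
    funext N
    rw [boundedGF_succ, if_neg (by omega), ih (by omega), Function.iterate_succ_apply', add_zero]

theorem boundedGF_add (m a : ℕ) : boundedGF m (a + m) = shiftedIter Polynomial.X a m := by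
  induction a with
  | zero =>
    rw [zero_add]
    cases m with
    | zero => exact boundedGF_eq_iterate (Or.inl rfl)
    | succ m =>
      funext N
      rw [boundedGF_succ, if_pos rfl, boundedGF_eq_iterate (Or.inr (Nat.lt_succ_self m)),
        shiftedIter, Function.iterate_succ_apply']
      rfl
  | succ a ih =>
    funext N
    rw [Nat.add_right_comm, boundedGF_succ, if_neg (by omega), ih, shiftedIter_succ, add_zero]

theorem card_Srmn_eq_coeff (r m n : ℕ) :
    (Nat.card (Srmn r m n) : ℤ) = (boundedGF m r n).coeff n := by
  have h : Srmn r m n = ((boundedSrm m r n).filter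
      fun L => n = ∑ i ∈ Finset.range r, (L i).sum id : Finset (ℕ → Finset ℕ)) := by
    ext L
    simp only [Srmn, Set.mem_ofPred_eq, Finset.coe_filter, mem_boundedSrm]
    constructor
    · rintro ⟨hL, hn⟩
      refine ⟨⟨hL, fun i hi => Finset.sup_le fun x hx => ?_⟩, hn.symm⟩
      calc x ≤ (L i).sum id := Finset.single_le_sum (f := id) (fun _ _ => Nat.zero_le _) hx
        _ ≤ ∑ i ∈ Finset.range r, (L i).sum id :=
          Finset.single_le_sum (f := fun i => (L i).sum id) (fun _ _ => Nat.zero_le _)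
            (Finset.mem_range.2 (by omega))
        _ ≤ _ := by omega
    · rintro ⟨⟨hL, -⟩, hn⟩
      exact ⟨hL, hn.symm⟩
  rw [h, Nat.card_coe_set_eq, Set.ncard_coe_finset, boundedGF, Polynomial.finsetSum_coeff]
  simp [Polynomial.coeff_X_pow]

/-- `♯S(r,m)_n = ♯S(r,r-m)_n`. -/
theorem stmt17 (r m n : ℕ) (hr : 1 ≤ r) (hm : m ≤ r) :
    Nat.card (Srmn r m n) = Nat.card (Srmn r (r - m) n) := by
  obtain ⟨a, rfl⟩ := Nat.exists_eq_add_of_le' hm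
  have h := congrArg (Polynomial.coeff · n)
    (congrFun (symmIter_comm (Polynomial.X : Polynomial ℤ) a m) n)
  simp only [coeff_symmIter _ _ le_rfl, ← boundedGF_add] at h
  rw [Nat.add_comm m a] at h
  rw [Nat.add_sub_cancel]
  exact_mod_cast (card_Srmn_eq_coeff (a + m) m n).trans
    (h.trans (card_Srmn_eq_coeff (a + m) a n).symm)
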